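/- Let G be a finite simple 3-regular bipartite graph on exactly 2h+8 vertices (h a natural number) having exactly six cycles of length 4, any two distinct 4-cycles of G sharing at most one edge. Let y be the number of dual-square subgraphs of G, and assume that G has exactly h + y cycles of length 6. Then N(P₅+K₂) = 144h² + 318h + 6y. -/

import Mathlib

open SimpleGraph

/-- The number of `k`-matchings of a graph `G`: `k`-element sets of pairwise disjoint
edges of `G`, identified with the matching subgraphs of `G` having exactly `k` edges. -/
noncomputable def numMatchings {V : Type*} (G : SimpleGraph V) (k : ℕ) : ℕ :=
  Set.ncard {H : G.Subgraph | H.IsMatching ∧ H.edgeSet.ncard = k}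

/-- The number of subgraphs of `G` isomorphic to the graph `X`. -/
noncomputable def numSubgraphs {V W : Type*} (G : SimpleGraph V) (X : SimpleGraph W) : ℕ :=
  Set.ncard {H : G.Subgraph | Nonempty (H.coe ≃g X)}

/-- The dual-square: two 4-cycles sharing exactly one edge; equivalently a 6-cycle
together with a chord joining two antipodal vertices. -/
noncomputable def dualSquare : SimpleGraph (Fin 6) :=
  cycleGraph 6 ⊔ SimpleGraph.fromEdgeSet {s(0, 3)}

theorem card_copy_eq {V W : Type*} [Finite V] (G : SimpleGraph V) (X : SimpleGraph W) :
    Nat.card (Copy X G) = numSubgraphs G X * Nat.card (X ≃g X) := by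
  let e : Copy X G ≃ Σ H : {H : G.Subgraph | Nonempty (H.coe ≃g X)}, (X ≃g H.1.coe) :=
    { toFun := fun f ↦ ⟨⟨f.toSubgraph, ⟨f.isoToSubgraph.symm⟩⟩, f.isoToSubgraph⟩
      invFun := fun p ↦ p.1.1.coeCopy.comp p.2.toCopy
      left_inv := fun f ↦ by ext; rfl
      right_inv := by
        rintro ⟨⟨H, hH⟩, φ⟩
        have hS : (H.coeCopy.comp φ.toCopy).toSubgraph = H := by
          simp only [Copy.toSubgraph]
          ext a b
          · simp only [Subgraph.map_verts, Set.mem_image, Subgraph.verts_top, Set.mem_univ,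
              true_and]
            constructor
            · rintro ⟨w, rfl⟩
              exact (φ w).2
            · intro ha
              exact ⟨φ.symm ⟨a, ha⟩, by
                change ((φ (φ.symm ⟨a, ha⟩) : H.verts) : V) = a
                simp⟩
          · simp only [Subgraph.map_adj, Relation.Map, Subgraph.top_adj]
            constructor
            · rintro ⟨u, v, huv, rfl, rfl⟩
              exact φ.map_adj_iff.2 huv
            · intro hab
              refine ⟨φ.symm ⟨a, H.edge_vert hab⟩, φ.symm ⟨b, H.edge_vert hab.symm⟩, ?_, ?_, ?_⟩
              · rw [φ.symm.map_adj_iff]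
                exact hab
              · change ((φ (φ.symm ⟨a, _⟩) : H.verts) : V) = a
                simp
              · change ((φ (φ.symm ⟨b, _⟩) : H.verts) : V) = b
                simp
        have key : ∀ (K : {H : G.Subgraph | Nonempty (H.coe ≃g X)}) (ψ : X ≃g K.1.coe),
            K.1 = H → (∀ w, (ψ w : V) = φ w) →
            (⟨K, ψ⟩ : Σ H : {H : G.Subgraph | Nonempty (H.coe ≃g X)}, (X ≃g H.1.coe)) =
              ⟨⟨H, hH⟩, φ⟩ := by
          rintro ⟨K, hK⟩ ψ hKH hψ
          obtain rfl : K = H := hKH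
          congr 1
          ext w
          exact hψ w
        exact key _ _ hS fun w ↦ rfl }
  rw [Nat.card_congr e]
  have e₂ : (Σ H : {H : G.Subgraph | Nonempty (H.coe ≃g X)}, (X ≃g H.1.coe)) ≃
      {H : G.Subgraph | Nonempty (H.coe ≃g X)} × (X ≃g X) :=
    (Equiv.sigmaCongrRight fun (H : {H : G.Subgraph | Nonempty (H.coe ≃g X)}) ↦
      ({ toFun := fun φ ↦ φ.trans H.2.some
         invFun := fun φ ↦ φ.trans H.2.some.symm
         left_inv := fun φ ↦ by ext; simp
         right_inv := fun φ ↦ by ext; simp } : (X ≃g H.1.coe) ≃ (X ≃g X))).trans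
      (Equiv.sigmaEquivProd _ _)
  rw [Nat.card_congr e₂, Nat.card_prod, numSubgraphs, Set.ncard_def, Nat.card]
  rfl

theorem card_iso_eq_card_perm {W : Type*} [Fintype W] [DecidableEq W] (X : SimpleGraph W)
    [DecidableRel X.Adj] :
    Nat.card (X ≃g X) =
      Fintype.card {σ : Equiv.Perm W // ∀ i j, X.Adj (σ i) (σ j) ↔ X.Adj i j} := by
  rw [← Nat.card_eq_fintype_card]
  exact Nat.card_congr
    { toFun := fun φ ↦ ⟨φ.toEquiv, fun i j ↦ φ.map_adj_iff⟩
      invFun := fun σ ↦ ⟨σ.1, fun {i j} ↦ σ.2 i j⟩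
      left_inv := fun φ ↦ rfl
      right_inv := fun σ ↦ rfl }

instance (n : ℕ) : DecidableRel (cycleGraph n).Adj := fun _ _ ↦
  decidable_of_iff _ cycleGraph_adj'.symm

theorem card_iso_cycleGraph_four : Nat.card (cycleGraph 4 ≃g cycleGraph 4) = 8 := by
  rw [card_iso_eq_card_perm]
  decide +kernel

theorem card_iso_cycleGraph_six : Nat.card (cycleGraph 6 ≃g cycleGraph 6) = 12 := by
  rw [card_iso_eq_card_perm]
  decide +kernel

instance (n : ℕ) : DecidableRel (pathGraph n).Adj := fun _ _ ↦
  decidable_of_iff _ pathGraph_adj.symm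

theorem card_iso_pathGraph_two : Nat.card (pathGraph 2 ≃g pathGraph 2) = 2 := by
  rw [card_iso_eq_card_perm]
  decide +kernel

theorem card_iso_pathGraph_six : Nat.card (pathGraph 6 ≃g pathGraph 6) = 2 := by
  rw [card_iso_eq_card_perm]
  decide +kernel

theorem isLeft_apply_inl (σ : (pathGraph 6 ⊕g pathGraph 2) ≃g (pathGraph 6 ⊕g pathGraph 2))
    (i : Fin 6) : (σ (.inl i)).isLeft := by
  have hadj : ∀ i j, (pathGraph 6).Adj i j →
      (pathGraph 6 ⊕g pathGraph 2).Adj (σ (.inl i)) (σ (.inl j)) := fun i j hij ↦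
    σ.map_adj_iff.2 (sum_adj_inl.2 hij)
  have hleft : ∀ u v, (pathGraph 6 ⊕g pathGraph 2).Adj u v → u.isLeft = v.isLeft := by
    rintro (u | u) (v | v) huv <;> simp_all
  have h1 : (σ (.inl 1)).isLeft := by
    have h0 := hadj 1 0 (by decide)
    have h2 := hadj 1 2 (by decide)
    have hne : σ (.inl 0) ≠ σ (.inl 2) := fun h ↦ by simpa using σ.injective h
    revert h0 h2 hne
    generalize σ (.inl 0) = a
    generalize σ (.inl 1) = b
    generalize σ (.inl 2) = c
    rcases a with a | a <;> rcases b with b | b <;> rcases c with c | c <;> simp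
    revert a b c
    decide
  have hstep : ∀ i j, (pathGraph 6).Adj i j → (σ (.inl i)).isLeft = (σ (.inl j)).isLeft :=
    fun i j hij ↦ hleft _ _ (hadj i j hij)
  have h01 := hstep 0 1 (by decide)
  have h12 := hstep 1 2 (by decide)
  have h23 := hstep 2 3 (by decide)
  have h34 := hstep 3 4 (by decide)
  have h45 := hstep 4 5 (by decide)
  fin_cases i <;> simp_all

theorem card_iso_path_sum :
    Nat.card ((pathGraph 6 ⊕g pathGraph 2) ≃g (pathGraph 6 ⊕g pathGraph 2)) = 4 := by
  have hbij : Function.Bijective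
      fun p : (pathGraph 6 ≃g pathGraph 6) × (pathGraph 2 ≃g pathGraph 2) ↦
        Iso.sumCongr p.1 p.2 := by
    constructor
    · rintro ⟨p, q⟩ ⟨p', q'⟩ h
      have hl : ∀ i, p i = p' i := fun i ↦ Sum.inl_injective (congrArg (fun f ↦ f (.inl i)) h)
      have hr : ∀ i, q i = q' i := fun i ↦ Sum.inr_injective (congrArg (fun f ↦ f (.inr i)) h)
      exact Prod.ext (RelIso.ext hl) (RelIso.ext hr)
    · intro σ
      have hmaps : Set.MapsTo σ.toEquiv (Set.range Sum.inl) (Set.range Sum.inl) := by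
        rintro _ ⟨i, rfl⟩
        obtain ⟨j, hj⟩ := Sum.isLeft_iff.1 (isLeft_apply_inl σ i)
        exact ⟨j, hj.symm⟩
      obtain ⟨⟨p, q⟩, hpq⟩ := Equiv.Perm.mem_sumCongrHom_range_of_perm_mapsTo_inl hmaps
      have hl : ∀ i, σ (.inl i) = .inl (p i) := fun i ↦
        (congrArg (fun f : Equiv.Perm _ ↦ f (.inl i)) hpq).symm
      have hr : ∀ i, σ (.inr i) = .inr (q i) := fun i ↦
        (congrArg (fun f : Equiv.Perm _ ↦ f (.inr i)) hpq).symm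
      refine ⟨(⟨p, fun {i j} ↦ ?_⟩, ⟨q, fun {i j} ↦ ?_⟩), ?_⟩
      · simpa [hl] using σ.map_adj_iff (v := .inl i) (w := .inl j)
      · simpa [hr] using σ.map_adj_iff (v := .inr i) (w := .inr j)
      · refine RelIso.ext fun v ↦ ?_
        rcases v with i | i
        · exact (hl i).symm
        · exact (hr i).symm
  rw [← Nat.card_congr (Equiv.ofBijective _ hbij), Nat.card_prod, card_iso_pathGraph_two,
    card_iso_pathGraph_six]

theorem card_eq_card_mul {α β γ : Type*} (s : Finset α) (t : Finset β) (F : β → Finset γ) (k : ℕ)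
    (e : α → β) (g : α → γ) (j : β → γ → α)
    (hs : ∀ x ∈ s, e x ∈ t ∧ g x ∈ F (e x) ∧ j (e x) (g x) = x)
    (ht : ∀ y ∈ t, ∀ w ∈ F y, j y w ∈ s ∧ e (j y w) = y ∧ g (j y w) = w)
    (hF : ∀ y ∈ t, (F y).card = k) : s.card = t.card * k := by
  have h : s.card = (t.sigma F).card := by
    refine Finset.card_nbij' (fun x ↦ ⟨e x, g x⟩) (fun p ↦ j p.1 p.2) ?_ ?_ ?_ ?_
    · intro x hx
      have := hs x hx
      simp_all
    · rintro ⟨y, w⟩ hp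
      have hp' := Finset.mem_sigma.1 hp
      exact (ht y hp'.1 w hp'.2).1
    · intro x hx
      exact (hs x hx).2.2
    · rintro ⟨y, w⟩ hp
      have hp' := Finset.mem_sigma.1 hp
      have := ht y hp'.1 w hp'.2
      simp_all
  rw [h, Finset.card_sigma, Finset.sum_congr rfl hF, Finset.sum_const, smul_eq_mul]

theorem card_reverse {V : Type*} (P Q : V × V × V × V × V × V → Prop) [DecidablePred P]
    [DecidablePred Q]
    (s : Finset (V × V × V × V × V × V))
    (hs : ∀ a b c d e f, (a, b, c, d, e, f) ∈ s → (f, e, d, c, b, a) ∈ s)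
    (hPQ : ∀ a b c d e f, P (a, b, c, d, e, f) ↔ Q (f, e, d, c, b, a)) :
    {p ∈ s | P p}.card = {p ∈ s | Q p}.card := by
  refine Finset.card_nbij'
    (fun p ↦ (p.2.2.2.2.2, p.2.2.2.2.1, p.2.2.2.1, p.2.2.1, p.2.1, p.1))
    (fun p ↦ (p.2.2.2.2.2, p.2.2.2.2.1, p.2.2.2.1, p.2.2.1, p.2.1, p.1)) ?_ ?_ ?_ ?_
  · rintro ⟨a, b, c, d, e, f⟩
    simp only [Finset.coe_filter, Set.mem_ofPred_eq, ← hPQ]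
    exact fun h ↦ ⟨hs _ _ _ _ _ _ h.1, h.2⟩
  · rintro ⟨a, b, c, d, e, f⟩
    simp only [Finset.coe_filter, Set.mem_ofPred_eq, hPQ]
    exact fun h ↦ ⟨hs _ _ _ _ _ _ h.1, h.2⟩
  · intro p _
    rfl
  · intro p _
    rfl

section Counting

variable {V : Type*} [Fintype V] (G : SimpleGraph V) [DecidableRel G.Adj]

/-- The ordered pairs of adjacent vertices. -/
def walks1 : Finset (V × V) := {p | G.Adj p.1 p.2}

variable {G} in
theorem card_walks1 (hreg : G.IsRegularOfDegree 3) :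
    (walks1 G).card = Fintype.card V * 3 := by
  refine card_eq_card_mul _ Finset.univ (fun a ↦ G.neighborFinset a) 3 (fun p ↦ p.1) (fun p ↦ p.2)
    (fun a b ↦ (a, b)) ?_ ?_ ?_
  · simp [walks1]
  · simp [walks1]
  · intro a _
    rw [G.card_neighborFinset_eq_degree, hreg a]

variable [DecidableEq V]

/-- The walks with two edges that never turn back. -/
def walks2 : Finset (V × V × V) :=
  {p | G.Adj p.1 p.2.1 ∧ G.Adj p.2.1 p.2.2 ∧ p.1 ≠ p.2.2}

/-- The walks with three edges that never turn back. -/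
def walks3 : Finset (V × V × V × V) :=
  {p | (G.Adj p.1 p.2.1 ∧ G.Adj p.2.1 p.2.2.1 ∧ p.1 ≠ p.2.2.1) ∧
    G.Adj p.2.2.1 p.2.2.2 ∧ p.2.1 ≠ p.2.2.2}

/-- The walks with four edges that never turn back. -/
def walks4 : Finset (V × V × V × V × V) :=
  {p | ((G.Adj p.1 p.2.1 ∧ G.Adj p.2.1 p.2.2.1 ∧ p.1 ≠ p.2.2.1) ∧
    G.Adj p.2.2.1 p.2.2.2.1 ∧ p.2.1 ≠ p.2.2.2.1) ∧
    G.Adj p.2.2.2.1 p.2.2.2.2 ∧ p.2.2.1 ≠ p.2.2.2.2}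

/-- The walks with five edges that never turn back. -/
def walks5 : Finset (V × V × V × V × V × V) :=
  {p | (((G.Adj p.1 p.2.1 ∧ G.Adj p.2.1 p.2.2.1 ∧ p.1 ≠ p.2.2.1) ∧
    G.Adj p.2.2.1 p.2.2.2.1 ∧ p.2.1 ≠ p.2.2.2.1) ∧
    G.Adj p.2.2.2.1 p.2.2.2.2.1 ∧ p.2.2.1 ≠ p.2.2.2.2.1) ∧
    G.Adj p.2.2.2.2.1 p.2.2.2.2.2 ∧ p.2.2.2.1 ≠ p.2.2.2.2.2}

/-- The cyclically ordered 4-cycles with a base point. -/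
def fourCycles : Finset (V × V × V × V) :=
  {p | G.Adj p.1 p.2.1 ∧ G.Adj p.2.1 p.2.2.1 ∧ G.Adj p.2.2.1 p.2.2.2 ∧ G.Adj p.2.2.2 p.1 ∧
    p.1 ≠ p.2.2.1 ∧ p.2.1 ≠ p.2.2.2}

/-- The based 4-cycles with a pendant edge at the last vertex. -/
def tailedCycles : Finset (V × V × V × V × V) :=
  {p | (p.1, p.2.1, p.2.2.1, p.2.2.2.1) ∈ fourCycles G ∧
    G.Adj p.2.2.2.1 p.2.2.2.2 ∧ p.1 ≠ p.2.2.2.2 ∧ p.2.2.1 ≠ p.2.2.2.2}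

/-- The walks with five edges that visit six vertices, when `G` is bipartite. -/
def paths5 : Finset (V × V × V × V × V × V) :=
  {p ∈ walks5 G | p.1 ≠ p.2.2.2.2.1 ∧ p.2.1 ≠ p.2.2.2.2.2}

variable {G}

theorem mem_walks5 {a b c d e f : V} : (a, b, c, d, e, f) ∈ walks5 G ↔
    (((G.Adj a b ∧ G.Adj b c ∧ a ≠ c) ∧ G.Adj c d ∧ b ≠ d) ∧ G.Adj d e ∧ c ≠ e) ∧
      G.Adj e f ∧ d ≠ f := by
  simp [walks5]

theorem mem_fourCycles {a b c d : V} : (a, b, c, d) ∈ fourCycles G ↔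
    G.Adj a b ∧ G.Adj b c ∧ G.Adj c d ∧ G.Adj d a ∧ a ≠ c ∧ b ≠ d := by
  simp [fourCycles]

theorem mem_tailedCycles {a b c d e : V} : (a, b, c, d, e) ∈ tailedCycles G ↔
    (G.Adj a b ∧ G.Adj b c ∧ G.Adj c d ∧ G.Adj d a ∧ a ≠ c ∧ b ≠ d) ∧
      G.Adj d e ∧ a ≠ e ∧ c ≠ e := by
  simp [tailedCycles, mem_fourCycles]

theorem mem_paths5 {a b c d e f : V} : (a, b, c, d, e, f) ∈ paths5 G ↔
    ((((G.Adj a b ∧ G.Adj b c ∧ a ≠ c) ∧ G.Adj c d ∧ b ≠ d) ∧ G.Adj d e ∧ c ≠ e) ∧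
      G.Adj e f ∧ d ≠ f) ∧ a ≠ e ∧ b ≠ f := by
  simp [paths5, mem_walks5]

theorem card_neighborFinset_erase (hreg : G.IsRegularOfDegree 3) {a b : V} (hab : G.Adj a b) :
    ((G.neighborFinset a).erase b).card = 2 := by
  rw [Finset.card_erase_of_mem (by simpa using hab), G.card_neighborFinset_eq_degree, hreg a]

theorem card_neighborFinset_erase_erase (hreg : G.IsRegularOfDegree 3) {a b c : V}
    (hab : G.Adj a b) (hac : G.Adj a c) (hbc : b ≠ c) :
    (((G.neighborFinset a).erase b).erase c).card = 1 := by
  rw [Finset.card_erase_of_mem (by simpa [hbc.symm] using hac), card_neighborFinset_erase hreg hab]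

theorem card_walks2 (hreg : G.IsRegularOfDegree 3) :
    (walks2 G).card = Fintype.card V * 6 := by
  rw [card_eq_card_mul (walks2 G) (walks1 G) (fun p ↦ (G.neighborFinset p.2).erase p.1) 2
    (fun p ↦ (p.1, p.2.1)) (fun p ↦ p.2.2) (fun p x ↦ (p.1, p.2, x)), card_walks1 hreg]
  · ring
  · rintro ⟨a, b, c⟩
    simp +contextual [walks1, walks2, eq_comm]
  · rintro ⟨a, b⟩
    simp +contextual [walks1, walks2, eq_comm]
  · rintro ⟨a, b⟩ h
    exact card_neighborFinset_erase hreg (by simpa [walks1] using h : G.Adj a b).symm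

theorem card_walks3 (hreg : G.IsRegularOfDegree 3) :
    (walks3 G).card = Fintype.card V * 12 := by
  rw [card_eq_card_mul (walks3 G) (walks2 G) (fun p ↦ (G.neighborFinset p.2.2).erase p.2.1) 2
    (fun p ↦ (p.1, p.2.1, p.2.2.1)) (fun p ↦ p.2.2.2) (fun p x ↦ (p.1, p.2.1, p.2.2, x)),
    card_walks2 hreg]
  · ring
  · rintro ⟨a, b, c, d⟩
    simp +contextual [walks2, walks3, eq_comm]
  · rintro ⟨a, b, c⟩
    simp +contextual [walks2, walks3, eq_comm]
  · rintro ⟨a, b, c⟩ h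
    simp only [walks2, Finset.mem_filter_univ] at h
    exact card_neighborFinset_erase hreg h.2.1.symm

theorem card_walks4 (hreg : G.IsRegularOfDegree 3) :
    (walks4 G).card = Fintype.card V * 24 := by
  rw [card_eq_card_mul (walks4 G) (walks3 G) (fun p ↦ (G.neighborFinset p.2.2.2).erase p.2.2.1) 2
    (fun p ↦ (p.1, p.2.1, p.2.2.1, p.2.2.2.1)) (fun p ↦ p.2.2.2.2)
    (fun p x ↦ (p.1, p.2.1, p.2.2.1, p.2.2.2, x)), card_walks3 hreg]
  · ring
  · rintro ⟨a, b, c, d, e⟩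
    simp +contextual [walks3, walks4, eq_comm]
  · rintro ⟨a, b, c, d⟩
    simp +contextual [walks3, walks4, eq_comm]
  · rintro ⟨a, b, c, d⟩ h
    simp only [walks3, Finset.mem_filter_univ] at h
    exact card_neighborFinset_erase hreg h.2.1.symm

theorem card_walks5 (hreg : G.IsRegularOfDegree 3) :
    (walks5 G).card = Fintype.card V * 48 := by
  rw [card_eq_card_mul (walks5 G) (walks4 G)
    (fun p ↦ (G.neighborFinset p.2.2.2.2).erase p.2.2.2.1) 2
    (fun p ↦ (p.1, p.2.1, p.2.2.1, p.2.2.2.1, p.2.2.2.2.1)) (fun p ↦ p.2.2.2.2.2)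
    (fun p x ↦ (p.1, p.2.1, p.2.2.1, p.2.2.2.1, p.2.2.2.2, x)), card_walks4 hreg]
  · ring
  · rintro ⟨a, b, c, d, e, f⟩
    simp +contextual [walks4, walks5, eq_comm]
  · rintro ⟨a, b, c, d, e⟩
    simp +contextual [walks4, walks5, eq_comm]
  · rintro ⟨a, b, c, d, e⟩ h
    simp only [walks4, Finset.mem_filter_univ] at h
    exact card_neighborFinset_erase hreg h.2.1.symm

theorem card_tailedCycles (hreg : G.IsRegularOfDegree 3) :
    (tailedCycles G).card = (fourCycles G).card := by
  rw [card_eq_card_mul (tailedCycles G) (fourCycles G)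
    (fun p ↦ ((G.neighborFinset p.2.2.2).erase p.1).erase p.2.2.1) 1
    (fun p ↦ (p.1, p.2.1, p.2.2.1, p.2.2.2.1)) (fun p ↦ p.2.2.2.2)
    (fun p x ↦ (p.1, p.2.1, p.2.2.1, p.2.2.2, x)), mul_one]
  · rintro ⟨a, b, c, d, e⟩
    simp +contextual [mem_tailedCycles, mem_fourCycles, eq_comm]
  · rintro ⟨a, b, c, d⟩
    simp +contextual [mem_tailedCycles, mem_fourCycles, eq_comm]
  · rintro ⟨a, b, c, d⟩ h
    obtain ⟨-, -, hcd, hda, hac, -⟩ := mem_fourCycles.1 h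
    exact card_neighborFinset_erase_erase hreg hda hcd.symm hac

theorem card_walks5_fst_eq (hreg : G.IsRegularOfDegree 3) :
    {p ∈ walks5 G | p.1 = p.2.2.2.2.1}.card = (fourCycles G).card * 2 := by
  refine card_eq_card_mul _ _ (fun p ↦ (G.neighborFinset p.1).erase p.2.2.2) 2
    (fun p ↦ (p.1, p.2.1, p.2.2.1, p.2.2.2.1)) (fun p ↦ p.2.2.2.2.2)
    (fun p x ↦ (p.1, p.2.1, p.2.2.1, p.2.2.2, p.1, x)) ?_ ?_ ?_
  · rintro ⟨a, b, c, d, e, f⟩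
    simp only [Finset.mem_filter, mem_walks5, mem_fourCycles, Finset.mem_erase,
      mem_neighborFinset]
    grind
  · rintro ⟨a, b, c, d⟩
    simp only [Finset.mem_filter, mem_walks5, mem_fourCycles, Finset.mem_erase,
      mem_neighborFinset]
    grind
  · rintro ⟨a, b, c, d⟩ h
    exact card_neighborFinset_erase hreg (mem_fourCycles.1 h).2.2.2.1.symm

theorem card_walks5_snd_eq (hreg : G.IsRegularOfDegree 3) :
    {p ∈ walks5 G | p.2.1 = p.2.2.2.2.2}.card = (fourCycles G).card * 2 := by
  rw [← card_walks5_fst_eq hreg]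
  refine card_reverse _ _ _ ?_ ?_
  · intro a b c d e f
    simp only [mem_walks5]
    grind [SimpleGraph.adj_comm]
  · intro a b c d e f
    exact eq_comm

theorem card_walks5_both_eq :
    {p ∈ walks5 G | p.1 = p.2.2.2.2.1 ∧ p.2.1 = p.2.2.2.2.2}.card = (fourCycles G).card := by
  refine Finset.card_nbij' (fun p ↦ (p.1, p.2.1, p.2.2.1, p.2.2.2.1))
    (fun p ↦ (p.1, p.2.1, p.2.2.1, p.2.2.2, p.1, p.2.1)) ?_ ?_ ?_ ?_
  · rintro ⟨a, b, c, d, e, f⟩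
    simp only [Finset.coe_filter, Set.mem_ofPred_eq, Finset.mem_coe, mem_walks5, mem_fourCycles]
    grind
  · rintro ⟨a, b, c, d⟩
    simp only [Finset.coe_filter, Set.mem_ofPred_eq, Finset.mem_coe, mem_walks5, mem_fourCycles]
    grind [SimpleGraph.adj_comm]
  · rintro ⟨a, b, c, d, e, f⟩
    simp only [Finset.coe_filter, Set.mem_ofPred_eq]
    grind
  · intro p _
    rfl

theorem card_paths5 (hreg : G.IsRegularOfDegree 3) :
    (paths5 G).card + (fourCycles G).card * 3 = Fintype.card V * 48 := by
  have h1 := card_walks5_fst_eq hreg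
  have h2 := card_walks5_snd_eq hreg
  have h3 := card_walks5_both_eq (G := G)
  have h4 := Finset.card_union_add_card_inter {p ∈ walks5 G | p.1 = p.2.2.2.2.1}
    {p ∈ walks5 G | p.2.1 = p.2.2.2.2.2}
  rw [← Finset.filter_or, ← Finset.filter_and] at h4
  have h5 := Finset.card_filter_add_card_filter_not (s := walks5 G)
    (fun p ↦ p.1 = p.2.2.2.2.1 ∨ p.2.1 = p.2.2.2.2.2)
  simp only [not_or] at h5
  rw [card_walks5 hreg] at h5
  simp only [paths5, ne_eq]
  omega

theorem card_paths5_adj_fst (hreg : G.IsRegularOfDegree 3)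
    (hK : ∀ a b x y z, G.Adj a x → G.Adj a y → G.Adj a z → G.Adj b x → G.Adj b y → G.Adj b z →
      a ≠ b → x ≠ y → x ≠ z → y ≠ z → False) :
    {p ∈ paths5 G | G.Adj p.1 p.2.2.2.1}.card = (fourCycles G).card * 2 := by
  rw [← card_tailedCycles hreg]
  refine card_eq_card_mul _ _ (fun p ↦ (G.neighborFinset p.2.2.2.2).erase p.2.2.2.1) 2
    (fun p ↦ (p.1, p.2.1, p.2.2.1, p.2.2.2.1, p.2.2.2.2.1)) (fun p ↦ p.2.2.2.2.2)
    (fun p x ↦ (p.1, p.2.1, p.2.2.1, p.2.2.2.1, p.2.2.2.2, x)) ?_ ?_ ?_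
  · rintro ⟨a, b, c, d, e, f⟩
    simp only [Finset.mem_filter, mem_paths5, mem_tailedCycles, Finset.mem_erase,
      mem_neighborFinset]
    grind [SimpleGraph.adj_comm]
  · rintro ⟨a, b, c, d, e⟩ h f hf
    simp only [Finset.mem_filter, mem_paths5, mem_tailedCycles, Finset.mem_erase,
      mem_neighborFinset] at h hf ⊢
    have hbf : b ≠ f := by
      rintro rfl
      have := hK b d a c e
      grind [SimpleGraph.adj_comm]
    grind [SimpleGraph.adj_comm]
  · rintro ⟨a, b, c, d, e⟩ h
    exact card_neighborFinset_erase hreg (mem_tailedCycles.1 h).2.1.symm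

theorem paths5_reverse (a b c d e f : V) :
    (a, b, c, d, e, f) ∈ paths5 G → (f, e, d, c, b, a) ∈ paths5 G := by
  simp only [mem_paths5]
  grind [SimpleGraph.adj_comm]

theorem card_paths5_adj_thd :
    {p ∈ paths5 G | G.Adj p.2.2.1 p.2.2.2.2.2}.card =
      {p ∈ paths5 G | G.Adj p.1 p.2.2.2.1}.card :=
  card_reverse _ _ _ paths5_reverse fun _ _ _ _ _ _ ↦ G.adj_comm _ _

theorem card_paths5_adj_snd (hreg : G.IsRegularOfDegree 3) :
    {p ∈ paths5 G | G.Adj p.2.1 p.2.2.2.2.1}.card = (fourCycles G).card := by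
  rw [← card_tailedCycles hreg, ← mul_one (tailedCycles G).card]
  refine card_eq_card_mul _ _
    (fun p ↦ ((G.neighborFinset p.1).erase p.2.1).erase p.2.2.2.1) 1
    (fun p ↦ (p.2.1, p.2.2.1, p.2.2.2.1, p.2.2.2.2.1, p.2.2.2.2.2)) (fun p ↦ p.1)
    (fun p x ↦ (x, p.1, p.2.1, p.2.2.1, p.2.2.2.1, p.2.2.2.2)) ?_ ?_ ?_
  · rintro ⟨a, b, c, d, e, f⟩
    simp only [Finset.mem_filter, mem_paths5, mem_tailedCycles, Finset.mem_erase,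
      mem_neighborFinset]
    grind [SimpleGraph.adj_comm]
  · rintro ⟨a, b, c, d, e⟩ h f hf
    simp only [Finset.mem_filter, mem_paths5, mem_tailedCycles, Finset.mem_erase,
      mem_neighborFinset] at h hf ⊢
    grind [SimpleGraph.adj_comm]
  · rintro ⟨a, b, c, d, e⟩ h
    have h := (mem_tailedCycles.1 h).1
    exact card_neighborFinset_erase_erase hreg h.1 h.2.2.2.1.symm h.2.2.2.2.2

/-- A 4-cycle as a copy of `cycleGraph 4`. -/
def fourCycleCopy {a b c d : V} (h : (a, b, c, d) ∈ fourCycles G) : Copy (cycleGraph 4) G where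
  toHom := ⟨![a, b, c, d], by
    have h := mem_fourCycles.1 h
    intro i j hij
    fin_cases i <;> fin_cases j <;> first
      | exact absurd hij (by decide)
      | (simp; grind [SimpleGraph.adj_comm])⟩
  injective' := by
    have h := mem_fourCycles.1 h
    intro i j hij
    have := h.1.ne
    have := h.2.1.ne
    have := h.2.2.1.ne
    have := h.2.2.2.1.ne
    fin_cases i <;> fin_cases j <;> simp at hij ⊢ <;> grind

theorem card_fourCycles : (fourCycles G).card = numSubgraphs G (cycleGraph 4) * 8 := by
  rw [← card_iso_cycleGraph_four, ← card_copy_eq, ← Nat.card_eq_finsetCard]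
  symm
  refine Nat.card_eq_of_bijective
    (fun f : Copy (cycleGraph 4) G ↦ ⟨(f 0, f 1, f 2, f 3), ?_⟩) ⟨?_, ?_⟩
  · have hadj : ∀ i j, (cycleGraph 4).Adj i j → G.Adj (f i) (f j) := fun i j hij ↦
      f.toHom.map_adj hij
    have hne : ∀ i j, i ≠ j → f i ≠ f j := fun i j hij h ↦ hij (f.injective h)
    refine mem_fourCycles.2 ⟨?_, ?_, ?_, ?_, ?_, ?_⟩ <;>
      first
      | exact hadj _ _ (by decide)
      | exact hne _ _ (by decide)
  · intro f g hfg
    simp only [Subtype.mk.injEq, Prod.mk.injEq] at hfg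
    ext i
    fin_cases i <;> simp [hfg]
  · rintro ⟨⟨a, b, c, d⟩, h⟩
    exact ⟨fourCycleCopy h, rfl⟩

theorem mem_edgeSet_fourCycleCopy {a b c d : V} (h : (a, b, c, d) ∈ fourCycles G) (e : Sym2 V) :
    e ∈ (fourCycleCopy h).toSubgraph.edgeSet ↔
      e = s(a, b) ∨ e = s(b, c) ∨ e = s(c, d) ∨ e = s(d, a) := by
  induction e with | _ u v
  simp only [Copy.toSubgraph, Subgraph.mem_edgeSet, Subgraph.map_adj, Relation.Map,
    Subgraph.top_adj]
  constructor
  · rintro ⟨i, j, hij, rfl, rfl⟩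
    fin_cases i <;> fin_cases j <;> first
      | exact absurd hij (by decide)
      | simp [fourCycleCopy]
  · have key : ∀ i j, (cycleGraph 4).Adj i j →
        s(u, v) = s(![a, b, c, d] i, ![a, b, c, d] j) →
        ∃ i j, (cycleGraph 4).Adj i j ∧ ![a, b, c, d] i = u ∧ ![a, b, c, d] j = v := by
      intro i j hij he
      rcases Sym2.eq_iff.1 he with ⟨rfl, rfl⟩ | ⟨rfl, rfl⟩
      · exact ⟨i, j, hij, rfl, rfl⟩
      · exact ⟨j, i, hij.symm, rfl, rfl⟩
    rintro (he | he | he | he)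
    · exact key 0 1 (by decide) he
    · exact key 1 2 (by decide) he
    · exact key 2 3 (by decide) he
    · exact key 3 0 (by decide) he

theorem not_three_common_neighbors
    (hshare : ∀ H₁ H₂ : G.Subgraph, Nonempty (H₁.coe ≃g cycleGraph 4) →
      Nonempty (H₂.coe ≃g cycleGraph 4) → H₁ ≠ H₂ →
      (H₁.edgeSet ∩ H₂.edgeSet).ncard ≤ 1)
    (a b x y z : V) (hax : G.Adj a x) (hay : G.Adj a y) (haz : G.Adj a z) (hbx : G.Adj b x)
    (hby : G.Adj b y) (hbz : G.Adj b z) (hab : a ≠ b) (hxy : x ≠ y) (hxz : x ≠ z) (hyz : y ≠ z) :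
    False := by
  have h₁ : (a, x, b, y) ∈ fourCycles G :=
    mem_fourCycles.2 ⟨hax, hbx.symm, hby, hay.symm, hab, hxy⟩
  have h₂ : (a, x, b, z) ∈ fourCycles G :=
    mem_fourCycles.2 ⟨hax, hbx.symm, hbz, haz.symm, hab, hxz⟩
  have hne : (fourCycleCopy h₁).toSubgraph ≠ (fourCycleCopy h₂).toSubgraph := by
    intro h
    have hmem : s(y, a) ∈ (fourCycleCopy h₁).toSubgraph.edgeSet := by
      simp only [mem_edgeSet_fourCycleCopy, or_true]
    rw [h, mem_edgeSet_fourCycleCopy] at hmem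
    have := hay.ne
    have := hby.ne
    simp only [Sym2.eq_iff] at hmem
    grind
  have h := hshare _ _ ⟨(fourCycleCopy h₁).isoToSubgraph.symm⟩
    ⟨(fourCycleCopy h₂).isoToSubgraph.symm⟩ hne
  have hsub : {s(a, x), s(x, b)} ⊆
      (fourCycleCopy h₁).toSubgraph.edgeSet ∩ (fourCycleCopy h₂).toSubgraph.edgeSet := by
    rintro e (rfl | rfl) <;> constructor <;>
      simp only [mem_edgeSet_fourCycleCopy, true_or, or_true]
  have h2 := (Set.ncard_le_ncard hsub (Set.toFinite _)).trans h
  rw [Set.ncard_pair (by simp; grind)] at h2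
  omega

theorem color_of_mem_paths5 {C : V → Bool} (hC : ∀ u v, G.Adj u v → C v = !C u)
    {a b c d e f : V} (hp : (a, b, c, d, e, f) ∈ paths5 G) :
    C b = !C a ∧ C c = C a ∧ C d = !C a ∧ C e = C a ∧ C f = !C a := by
  have h := (mem_paths5.1 hp).1
  have hb := hC a b h.1.1.1.1
  have hc := hC b c h.1.1.1.2.1
  have hd := hC c d h.1.1.2.1
  have he := hC d e h.1.2.1
  have hf := hC e f h.2.1
  simp_all

theorem nodup_of_mem_paths5 {C : V → Bool} (hC : ∀ u v, G.Adj u v → C v = !C u)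
    {a b c d e f : V} (hp : (a, b, c, d, e, f) ∈ paths5 G) : [a, b, c, d, e, f].Nodup := by
  have h := mem_paths5.1 hp
  obtain ⟨hb, hc, hd, he, hf⟩ := color_of_mem_paths5 hC hp
  have hne : ∀ u v, C u = (!C v) → u ≠ v := by
    rintro u _ huv rfl
    simp at huv
  have hab := hne a b (by simp [*])
  have had := hne a d (by simp [*])
  have haf := hne a f (by simp [*])
  have hbc := hne b c (by simp [*])
  have hbe := hne b e (by simp [*])
  have hcd := hne c d (by simp [*])
  have hcf := hne c f (by simp [*])
  have hde := hne d e (by simp [*])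
  have hef := hne e f (by simp [*])
  simp [*]

theorem card_paths5_adj_ends (C : V → Bool) (hC : ∀ u v, G.Adj u v → C v = !C u) :
    {p ∈ paths5 G | G.Adj p.1 p.2.2.2.2.2}.card = numSubgraphs G (cycleGraph 6) * 12 := by
  rw [← card_iso_cycleGraph_six, ← card_copy_eq, ← Nat.card_eq_finsetCard]
  symm
  refine Nat.card_eq_of_bijective
    (fun f : Copy (cycleGraph 6) G ↦ ⟨(f 0, f 1, f 2, f 3, f 4, f 5), ?_⟩) ⟨?_, ?_⟩
  · have hadj : ∀ i j, (cycleGraph 6).Adj i j → G.Adj (f i) (f j) := fun i j hij ↦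
      f.toHom.map_adj hij
    have hne : ∀ i j, i ≠ j → f i ≠ f j := fun i j hij h ↦ hij (f.injective h)
    simp only [Finset.mem_filter, mem_paths5]
    refine ⟨⟨⟨⟨⟨⟨?_, ?_, ?_⟩, ?_, ?_⟩, ?_, ?_⟩, ?_, ?_⟩, ?_, ?_⟩, ?_⟩ <;>
      first
      | exact hadj _ _ (by decide)
      | exact hne _ _ (by decide)
  · intro f g hfg
    simp only [Subtype.mk.injEq, Prod.mk.injEq] at hfg
    ext i
    fin_cases i <;> simp [hfg]
  · rintro ⟨⟨a, b, c, d, e, f⟩, h⟩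
    have hne := nodup_of_mem_paths5 hC (Finset.mem_filter.1 h).1
    simp only [Finset.mem_filter, mem_paths5] at h
    refine ⟨⟨⟨![a, b, c, d, e, f], ?_⟩, ?_⟩, rfl⟩
    · intro i j hij
      fin_cases i <;> fin_cases j <;> first
        | exact absurd hij (by decide)
        | (simp; grind [SimpleGraph.adj_comm])
    · intro i j hij
      exact (List.nodup_ofFn (f := ![a, b, c, d, e, f])).1 (by simpa using hne) hij

/-- The six vertices of a walk. -/
def support5 (p : V × V × V × V × V × V) : Finset V :=
  {p.1, p.2.1, p.2.2.1, p.2.2.2.1, p.2.2.2.2.1, p.2.2.2.2.2}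

variable (G) in
/-- The ordered adjacent pairs of vertices avoiding `S`. -/
def dartsAvoiding (S : Finset V) : Finset (V × V) :=
  {q | G.Adj q.1 q.2 ∧ q.1 ∉ S ∧ q.2 ∉ S}

theorem card_dartsAvoiding (hreg : G.IsRegularOfDegree 3) (S : Finset V) :
    ((dartsAvoiding G S).card : ℤ) = 3 * Fintype.card V - 6 * S.card +
      ∑ a ∈ S, ∑ b ∈ S, if G.Adj a b then 1 else 0 := by
  have hdeg : ∀ a, ∑ b, (if G.Adj a b then (1 : ℤ) else 0) = 3 := fun a ↦ by
    rw [Finset.sum_boole, ← G.neighborFinset_eq_filter, G.card_neighborFinset_eq_degree, hreg a]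
    rfl
  have hrow : ∀ a, ∑ b ∈ Sᶜ, (if G.Adj a b then (1 : ℤ) else 0) =
      3 - ∑ b ∈ S, if G.Adj a b then 1 else 0 := fun a ↦ by
    rw [← hdeg a, ← Finset.sum_add_sum_compl S]
    ring
  have hcol : ∑ a, ∑ b ∈ S, (if G.Adj a b then (1 : ℤ) else 0) = 3 * S.card := by
    rw [Finset.sum_comm]
    simp only [G.adj_comm _, hdeg]
    simp [mul_comm]
  have h : ((dartsAvoiding G S).card : ℤ) =
      ∑ a ∈ Sᶜ, ∑ b ∈ Sᶜ, if G.Adj a b then 1 else 0 := by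
    rw [← Finset.sum_product', Finset.sum_boole]
    congr 2
    ext ⟨a, b⟩
    simp [dartsAvoiding, and_comm, and_assoc]
  rw [h, Finset.sum_congr rfl fun a _ ↦ hrow a, Finset.sum_sub_distrib]
  rw [← Finset.sum_add_sum_compl S] at hcol
  rw [Finset.sum_const, nsmul_eq_mul, Finset.card_compl, Nat.cast_sub S.card_le_univ]
  linarith

theorem card_dartsAvoiding_support5 (hreg : G.IsRegularOfDegree 3)
    {C : V → Bool} (hC : ∀ u v, G.Adj u v → C v = !C u)
    {p : V × V × V × V × V × V} (hp : p ∈ paths5 G) :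
    ((dartsAvoiding G (support5 p)).card : ℤ) = 3 * Fintype.card V - 26 +
      2 * ((if G.Adj p.1 p.2.2.2.1 then 1 else 0) +
        (if G.Adj p.2.1 p.2.2.2.2.1 then 1 else 0) +
        (if G.Adj p.2.2.1 p.2.2.2.2.2 then 1 else 0) +
        (if G.Adj p.1 p.2.2.2.2.2 then 1 else 0)) := by
  obtain ⟨a, b, c, d, e, f⟩ := p
  have h := mem_paths5.1 hp
  have hne := nodup_of_mem_paths5 hC hp
  obtain ⟨hCb, hCc, hCd, hCe, hCf⟩ := color_of_mem_paths5 hC hp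
  have hn : ∀ u v, C u = C v → ¬ G.Adj u v := fun u v huv hadj ↦ by
    have := hC u v hadj
    simp [huv] at this
  rw [card_dartsAvoiding hreg]
  have hac := hn a c (by simp [*])
  have hae := hn a e (by simp [*])
  have hce := hn c e (by simp [*])
  have hbd := hn b d (by simp [*])
  have hbf := hn b f (by simp [*])
  have hdf := hn d f (by simp [*])
  simp only [List.nodup_cons, List.mem_cons, List.not_mem_nil, or_false, not_or] at hne
  obtain ⟨⟨⟨⟨⟨hab, hbc, -⟩, hcd, -⟩, hde, -⟩, hef, -⟩, -⟩ := h
  simp only [support5]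
  repeat rw [Finset.card_insert_of_notMem (by simp [hne])]
  simp only [Finset.card_singleton]
  simp only [Finset.sum_insert (show a ∉ ({b, c, d, e, f} : Finset V) by simp [hne]),
    Finset.sum_insert (show b ∉ ({c, d, e, f} : Finset V) by simp [hne]),
    Finset.sum_insert (show c ∉ ({d, e, f} : Finset V) by simp [hne]),
    Finset.sum_insert (show d ∉ ({e, f} : Finset V) by simp [hne]),
    Finset.sum_insert (show e ∉ ({f} : Finset V) by simp [hne]), Finset.sum_singleton]
  simp only [hab, hbc, hcd, hde, hef, hab.symm, hbc.symm, hcd.symm, hde.symm, hef.symm,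
    hac, hae, hce, hbd, hbf, hdf,
    G.adj_comm c a, G.adj_comm e a, G.adj_comm e c, G.adj_comm d b, G.adj_comm f b, G.adj_comm f d,
    G.adj_comm d a, G.adj_comm e b, G.adj_comm f c, G.adj_comm f a, SimpleGraph.irrefl,
    if_true, if_false]
  push_cast
  ring

theorem card_path_sum_edge {C : V → Bool} (hC : ∀ u v, G.Adj u v → C v = !C u) :
    numSubgraphs G (pathGraph 6 ⊕g pathGraph 2) * 4 =
      ((paths5 G).sigma fun p ↦ dartsAvoiding G (support5 p)).card := by
  rw [← card_iso_path_sum, ← card_copy_eq, ← Nat.card_eq_finsetCard]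
  refine Nat.card_eq_of_bijective
    (fun f : Copy (pathGraph 6 ⊕g pathGraph 2) G ↦
      ⟨⟨(f (.inl 0), f (.inl 1), f (.inl 2), f (.inl 3), f (.inl 4), f (.inl 5)),
        (f (.inr 0), f (.inr 1))⟩, ?_⟩) ⟨?_, ?_⟩
  · have hadjl : ∀ i j, (pathGraph 6).Adj i j → G.Adj (f (.inl i)) (f (.inl j)) := fun i j hij ↦
      f.toHom.map_adj (sum_adj_inl.2 hij)
    have hadjr : ∀ i j, (pathGraph 2).Adj i j → G.Adj (f (.inr i)) (f (.inr j)) := fun i j hij ↦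
      f.toHom.map_adj (sum_adj_inr.2 hij)
    have hne : ∀ i j, i ≠ j → f i ≠ f j := fun i j hij h ↦ hij (f.injective h)
    simp only [Finset.mem_sigma, mem_paths5, dartsAvoiding, Finset.mem_filter_univ, support5,
      Finset.mem_insert, Finset.mem_singleton, not_or]
    refine ⟨⟨⟨⟨⟨⟨?_, ?_, ?_⟩, ?_, ?_⟩, ?_, ?_⟩, ?_, ?_⟩, ?_, ?_⟩, ?_, ⟨?_, ?_, ?_, ?_, ?_, ?_⟩,
      ?_, ?_, ?_, ?_, ?_, ?_⟩ <;>
      first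
      | exact hadjl _ _ (by decide)
      | exact hadjr _ _ (by decide)
      | exact hne _ _ (by decide)
  · intro f g hfg
    simp only [Subtype.mk.injEq, Sigma.mk.injEq, heq_eq_eq, Prod.mk.injEq] at hfg
    ext i
    rcases i with i | i <;> fin_cases i <;> simp [hfg]
  · rintro ⟨⟨⟨a, b, c, d, e, f⟩, x, y⟩, h⟩
    obtain ⟨hp, hq⟩ := Finset.mem_sigma.1 h
    have hne := nodup_of_mem_paths5 hC hp
    have hp' := mem_paths5.1 hp
    simp only [dartsAvoiding, Finset.mem_filter_univ, support5, Finset.mem_insert,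
      Finset.mem_singleton, not_or] at hq
    refine ⟨⟨⟨Sum.elim ![a, b, c, d, e, f] ![x, y], ?_⟩, ?_⟩, rfl⟩
    · rintro (i | i) (j | j) hij
      · rw [sum_adj_inl] at hij
        fin_cases i <;> fin_cases j <;> first
          | exact absurd hij (by decide)
          | (simp; grind [SimpleGraph.adj_comm])
      · simp at hij
      · simp at hij
      · rw [sum_adj_inr] at hij
        fin_cases i <;> fin_cases j <;> first
          | exact absurd hij (by decide)
          | (simp; grind [SimpleGraph.adj_comm])
    · have hxy := hq.1.ne
      refine Function.Injective.sumElim ?_ ?_ ?_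
      · exact (List.nodup_ofFn (f := ![a, b, c, d, e, f])).1 (by simpa using hne)
      · exact (List.nodup_ofFn (f := ![x, y])).1 (by simpa using hxy)
      · intro i j
        fin_cases i <;> fin_cases j <;> simp <;> grind

end Counting

theorem stmt_17 {V : Type*} [Fintype V] [DecidableEq V] (G : SimpleGraph V) [DecidableRel G.Adj]
    (hreg : G.IsRegularOfDegree 3) (hbip : G.Colorable 2) (h : ℕ)
    (hcard : Fintype.card V = 2 * h + 8)
    (hsix : numSubgraphs G (cycleGraph 4) = 6)
    (hshare : ∀ H₁ H₂ : G.Subgraph, Nonempty (H₁.coe ≃g cycleGraph 4) →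
      Nonempty (H₂.coe ≃g cycleGraph 4) → H₁ ≠ H₂ →
      (H₁.edgeSet ∩ H₂.edgeSet).ncard ≤ 1)
    (y : ℕ) (hy : y = numSubgraphs G dualSquare)
    (hsixcycles : numSubgraphs G (cycleGraph 6) = h + y) :
    numSubgraphs G (pathGraph 6 ⊕g pathGraph 2) = 144 * h ^ 2 + 318 * h + 6 * y := by
  obtain ⟨C⟩ := hbip
  have hC : ∀ u v, G.Adj u v → (decide (C v = 0)) = !(decide (C u = 0)) := by
    intro u v huv
    have := C.valid huv
    revert this
    generalize C u = i
    generalize C v = j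
    revert i j
    decide
  have h4 := card_fourCycles (G := G)
  rw [hsix] at h4
  have hp := card_paths5 hreg
  have hfst := card_paths5_adj_fst hreg (not_three_common_neighbors hshare)
  have hthd := card_paths5_adj_thd (G := G)
  have hsnd := card_paths5_adj_snd hreg
  have hends := card_paths5_adj_ends (G := G) _ hC
  have hN := card_path_sum_edge hC
  rw [hfst] at hthd
  rw [hsixcycles] at hends
  rw [h4] at hp hfst hthd hsnd
  rw [hcard] at hp
  have hp' : ((paths5 G).card : ℤ) = 96 * h + 240 := by omega
  have hsum : (numSubgraphs G (pathGraph 6 ⊕g pathGraph 2) * 4 : ℤ) =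
      (96 * h + 240) * (6 * h - 2) + 2 * (96 + 48 + 96 + (h + y) * 12) := by
    have hN' := congrArg (Nat.cast : ℕ → ℤ) hN
    rw [Finset.card_sigma, Nat.cast_sum, Finset.sum_congr rfl fun p hp ↦
      card_dartsAvoiding_support5 hreg hC hp, Finset.sum_add_distrib, ← Finset.mul_sum,
      Finset.sum_add_distrib, Finset.sum_add_distrib, Finset.sum_add_distrib, Finset.sum_const,
      Finset.sum_boole, Finset.sum_boole, Finset.sum_boole, Finset.sum_boole, hfst, hthd, hsnd,
      hends, nsmul_eq_mul, hp', hcard] at hN'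
    push_cast at hN'
    rw [hN']
    ring
  zify
  linarith
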